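/- The variance of the discrepancy satisfies lim_{n→∞} Var(𝔇_n)/n = 1/(2α+1). -/

import Mathlib

open MeasureTheory ProbabilityTheory Filter

/-- The asymptotic condition `1/w(n) = n^α (1 + 2B/n + O(1/n²))` on the weight function. -/
def WeightAsymp (w : ℕ → ℝ) (α B : ℝ) : Prop :=
  ∃ C₀ > (0:ℝ), ∃ N₀ : ℕ, ∀ n : ℕ, N₀ ≤ n →
    |1 / w n - (n:ℝ) ^ α - 2 * B * (n:ℝ) ^ (α - 1)| ≤ C₀ * (n:ℝ) ^ (α - 2)

/-- The three admissible choices of `(b, r)` in terms of the weight function `w`. -/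
def UrnChoice (w b r : ℕ → ℝ) : Prop :=
  (∀ i, b i = w (2*i) ∧ r i = w (2*i+1)) ∨
  (∀ i, b i = w (2*i+1) ∧ r i = w (2*i)) ∨
  (∀ i, b i = w (2*i) ∧ r i = w (2*i))

/-- A generalized Pólya urn process: `Bl n` and `Re n` are the numbers of blue and red
balls drawn in the first `n` draws; started at `(0,0)`, exactly one coordinate increases
by `1` at each step, and conditionally on the past the blue coordinate increases with
probability `b(Bl n)/(b(Bl n) + r(Re n))`. -/
structure Urn {Ω : Type*} [MeasurableSpace Ω] (μ : Measure Ω) (b r : ℕ → ℝ) where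
  Bl : ℕ → Ω → ℕ
  Re : ℕ → Ω → ℕ
  meas_Bl : ∀ n, Measurable (Bl n)
  meas_Re : ∀ n, Measurable (Re n)
  init_Bl : ∀ ω, Bl 0 ω = 0
  init_Re : ∀ ω, Re 0 ω = 0
  step : ∀ n ω, (Bl (n+1) ω = Bl n ω + 1 ∧ Re (n+1) ω = Re n ω) ∨
                (Bl (n+1) ω = Bl n ω ∧ Re (n+1) ω = Re n ω + 1)
  markov : ∀ n : ℕ,
    μ[(fun ω => if Bl (n+1) ω = Bl n ω + 1 then (1:ℝ) else 0) |
        ⨆ j ∈ Set.Iic n, MeasurableSpace.comap (fun ω => (Bl j ω, Re j ω)) inferInstance]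
      =ᵐ[μ] fun ω => b (Bl n ω) / (b (Bl n ω) + r (Re n ω))

namespace Urn

variable {Ω : Type*} [MeasurableSpace Ω] {μ : Measure Ω} {b r : ℕ → ℝ}

/-- The discrepancy `𝔇_n = ℜ_n − 𝔅_n`. -/
def D (U : Urn μ b r) (n : ℕ) (ω : Ω) : ℤ := (U.Re n ω : ℤ) - (U.Bl n ω : ℤ)

/-- `τ_k^𝔅`, the number of draws until the `k`-th blue ball. -/
noncomputable def tau (U : Urn μ b r) : ℕ → Ω → ℕ
  | 0 => fun _ => 0
  | k+1 => fun ω => sInf {n : ℕ | U.tau k ω < n ∧ U.Bl n ω = U.Bl (n-1) ω + 1}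

/-- The natural filtration `ℱ_n = σ((𝔅_j, ℜ_j), j ≤ n)`. -/
def F (U : Urn μ b r) (n : ℕ) : MeasurableSpace Ω :=
  ⨆ j ∈ Set.Iic n, MeasurableSpace.comap (fun ω => (U.Bl j ω, U.Re j ω)) inferInstance

end Urn

section RealPowers

lemma one_sub_rpow_le {α t : ℝ} (ht0 : 0 ≤ t) (ht1 : t ≤ 1) :
    1 - t ^ α ≤ max 1 α * (1 - t) := by
  rcases le_total 1 α with h | h
  · have := one_add_mul_self_le_rpow_one_add (s := t - 1) (by linarith) h
    rw [max_eq_right h]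
    rw [show 1 + (t - 1) = t by ring] at this
    linarith
  · rw [max_eq_left h]
    have : t ^ (1:ℝ) ≤ t ^ α := by
      rcases ht0.eq_or_lt with rfl | h0
      · rw [Real.zero_rpow one_ne_zero]
        exact Real.rpow_nonneg le_rfl _
      · exact Real.rpow_le_rpow_of_exponent_ge h0 ht1 h
    rw [Real.rpow_one] at this
    linarith

lemma min_mul_one_sub_le {α t : ℝ} (hα : 0 < α) (ht0 : 0 ≤ t) (ht1 : t ≤ 1) :
    min 1 α * (1 - t) ≤ 1 - t ^ α := by
  rcases le_total 1 α with h | h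
  · rw [min_eq_left h]
    have : t ^ α ≤ t ^ (1:ℝ) := Real.rpow_le_rpow_of_exponent_ge' ht0 ht1 zero_le_one h
    rw [Real.rpow_one] at this
    linarith
  · rw [min_eq_right h]
    have := rpow_one_add_le_one_add_mul_self (s := t - 1) (by linarith) hα.le h
    rw [show 1 + (t - 1) = t by ring] at this
    linarith

/-- On `[0, 4y]` the power function is Lipschitz with constant of order `y ^ (α - 1)`. -/
lemma abs_rpow_sub_rpow_le {α x y : ℝ} (hα : 0 < α) (hx : 0 ≤ x) (hy : 0 < y) (hxy : x ≤ 4 * y) :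
    |x ^ α - y ^ α| ≤ max 1 α * 4 ^ α * (|x - y| * y ^ (α - 1)) := by
  have hm : 0 < max 1 α := lt_max_of_lt_left one_pos
  have hya : 0 < y ^ α := Real.rpow_pos_of_pos hy _
  rw [Real.rpow_sub_one hy.ne']
  rcases le_total x y with h | h
  · have h1 := one_sub_rpow_le (α := α) (t := x / y) (by positivity) (by rwa [div_le_one hy])
    rw [Real.div_rpow hx hy.le] at h1
    rw [abs_sub_comm, abs_sub_comm x, abs_of_nonneg (sub_nonneg.2 h),
      abs_of_nonneg (sub_nonneg.2 (Real.rpow_le_rpow hx h hα.le))]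
    have h4 : (1:ℝ) ≤ 4 ^ α := Real.one_le_rpow (by norm_num) hα.le
    calc y ^ α - x ^ α = (1 - x ^ α / y ^ α) * y ^ α := by field_simp
      _ ≤ (max 1 α * (1 - x / y)) * y ^ α := by gcongr
      _ = max 1 α * 1 * ((y - x) * (y ^ α / y)) := by field_simp
      _ ≤ _ := by
        have : 0 ≤ y - x := by linarith
        gcongr
  · have hx0 : 0 < x := hy.trans_le h
    have hxa : 0 < x ^ α := Real.rpow_pos_of_pos hx0 _
    have h1 := one_sub_rpow_le (α := α) (t := y / x) (by positivity) (by rwa [div_le_one hx0])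
    rw [Real.div_rpow hy.le hx] at h1
    rw [abs_of_nonneg (sub_nonneg.2 h),
      abs_of_nonneg (sub_nonneg.2 (Real.rpow_le_rpow hy.le h hα.le))]
    have h5 : 0 ≤ x - y := by linarith
    calc x ^ α - y ^ α = (1 - y ^ α / x ^ α) * x ^ α := by field_simp
      _ ≤ (max 1 α * (1 - y / x)) * x ^ α := by gcongr
      _ = max 1 α * (x - y) * (x ^ α / x) := by field_simp
      _ ≤ max 1 α * (x - y) * ((4 * y) ^ α / y) := by gcongr
      _ = _ := by rw [Real.mul_rpow (by norm_num) hy.le]; ring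

lemma rpow_sub_one_le_of_le_two_mul {α x y : ℝ} (hα : 0 < α) (hy : 0 < y) (hyx : y ≤ x)
    (hxy : x ≤ 2 * y) : x ^ (α - 1) ≤ 2 ^ α * y ^ (α - 1) := by
  have hx : 0 < x := hy.trans_le hyx
  rw [Real.rpow_sub_one hx.ne', Real.rpow_sub_one hy.ne', ← mul_div_assoc,
    ← Real.mul_rpow (by norm_num) hy.le]
  gcongr

lemma sum_rpow_sub_one_le {α : ℝ} (hα : 0 < α) (n : ℕ) :
    ∑ i ∈ Finset.range n, ((i:ℝ) + 1) ^ (α - 1) ≤ (min 1 α)⁻¹ * (n:ℝ) ^ α := by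
  have hm : 0 < min 1 α := lt_min one_pos hα
  induction n with
  | zero => simp [Real.zero_rpow hα.ne']
  | succ n ih =>
    rw [Finset.sum_range_succ]
    have hn : (0:ℝ) < n + 1 := by positivity
    have h1 := min_mul_one_sub_le (t := (n:ℝ) / (n + 1)) hα (by positivity)
      ((div_le_one hn).2 (by linarith))
    rw [Real.div_rpow (by positivity) hn.le] at h1
    have hna : (0:ℝ) < ((n:ℝ) + 1) ^ α := Real.rpow_pos_of_pos hn _
    have h2 : ((n:ℝ) + 1) ^ (α - 1) ≤ (min 1 α)⁻¹ * (((n:ℝ) + 1) ^ α - (n:ℝ) ^ α) := by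
      rw [Real.rpow_sub_one hn.ne', inv_mul_eq_div, le_div_iff₀ hm]
      calc ((n:ℝ) + 1) ^ α / (n + 1) * min 1 α
          = (min 1 α * (1 - (n:ℝ) / (n + 1))) * ((n:ℝ) + 1) ^ α := by field_simp; ring
        _ ≤ (1 - (n:ℝ) ^ α / ((n:ℝ) + 1) ^ α) * ((n:ℝ) + 1) ^ α := by gcongr
        _ = _ := by field_simp
    push_cast
    linarith

lemma tendsto_rpow_succ_sub_div (s : ℝ) :
    Tendsto (fun k : ℕ => (((k:ℝ) + 1) ^ s - (k:ℝ) ^ s) / (k:ℝ) ^ (s - 1)) atTop (nhds s) := by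
  have h1 : HasDerivAt (fun x : ℝ => x ^ s) s 1 := by
    simpa using Real.hasDerivAt_rpow_const (x := 1) (p := s) (Or.inl one_ne_zero)
  have h2 := h1.tendsto_slope_zero_right
  have h3 : Tendsto (fun k : ℕ => ((k:ℝ))⁻¹) atTop (nhdsWithin 0 (Set.Ioi 0)) :=
    tendsto_inv_atTop_nhdsGT_zero.comp tendsto_natCast_atTop_atTop
  refine (h2.comp h3).congr' ?_
  filter_upwards [eventually_gt_atTop 0] with k hk
  have hk0 : (0:ℝ) < k := by exact_mod_cast hk
  have hks : (0:ℝ) < (k:ℝ) ^ s := Real.rpow_pos_of_pos hk0 _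
  simp only [Function.comp, inv_inv, Real.one_rpow, smul_eq_mul]
  rw [Real.rpow_sub_one hk0.ne', show (k:ℝ) + 1 = k * (1 + (k:ℝ)⁻¹) by field_simp,
    Real.mul_rpow hk0.le (by positivity)]
  field_simp

/-- A sequence with the growth of `k ^ s` has partial sums with the growth of
`n ^ (s + 1) / (s + 1)`. -/
lemma tendsto_sum_div_rpow {s : ℝ} (hs : 0 < s) {a : ℕ → ℝ}
    (ha : Tendsto (fun k : ℕ => a k / (k:ℝ) ^ s) atTop (nhds 1)) :
    Tendsto (fun n : ℕ => (∑ k ∈ Finset.range n, a k) / (n:ℝ) ^ (s + 1)) atTop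
      (nhds (1 / (s + 1))) := by
  set g : ℕ → ℝ := fun k => ((k:ℝ) + 1) ^ (s + 1) - (k:ℝ) ^ (s + 1) with hg
  have hsum : ∀ n : ℕ, ∑ k ∈ Finset.range n, g k = (n:ℝ) ^ (s + 1) := by
    intro n
    have := Finset.sum_range_sub (fun k : ℕ => (k:ℝ) ^ (s + 1)) n
    simpa [hg, Real.zero_rpow (by positivity : s + 1 ≠ 0)] using this
  have hgpos : ∀ k, 0 < g k := fun k =>
    sub_pos.2 (Real.rpow_lt_rpow (by positivity) (by linarith) (by positivity))
  have hag : Tendsto (fun k => a k / g k) atTop (nhds (1 / (s + 1))) := by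
    have h := ha.div (tendsto_rpow_succ_sub_div (s + 1)) (by positivity)
    refine h.congr' ?_
    filter_upwards [eventually_gt_atTop 0] with k hk
    have hk0 : (0:ℝ) < k := by exact_mod_cast hk
    have hks : (0:ℝ) < (k:ℝ) ^ s := Real.rpow_pos_of_pos hk0 _
    have := (hgpos k).ne'
    simp only [Pi.div_apply, add_sub_cancel_right]
    change _ / (g k / _) = _
    field_simp
  have ho : (fun k => a k - 1 / (s + 1) * g k) =o[atTop] g := by
    rw [Asymptotics.isLittleO_iff_tendsto (fun k hk => absurd hk (hgpos k).ne')]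
    have := hag.sub_const (1 / (s + 1))
    rw [sub_self] at this
    refine this.congr fun k => ?_
    have := (hgpos k).ne'
    field_simp
  have hinf : Tendsto (fun n => ∑ k ∈ Finset.range n, g k) atTop atTop := by
    simp only [hsum]
    exact (tendsto_rpow_atTop (by positivity)).comp tendsto_natCast_atTop_atTop
  have hO := (ho.sum_range (fun k => (hgpos k).le) hinf).tendsto_div_nhds_zero.add_const
    (1 / (s + 1))
  rw [zero_add] at hO
  refine hO.congr' ?_
  filter_upwards [eventually_gt_atTop 0] with n hn
  have hn0 : (0:ℝ) < (n:ℝ) ^ (s + 1) := Real.rpow_pos_of_pos (by exact_mod_cast hn) _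
  rw [Finset.sum_sub_distrib, ← Finset.mul_sum, hsum]
  field_simp
  ring

end RealPowers

/-- Quantitative form of `p i ≈ (2 i) ^ α`, valid for every index. -/
structure RateBounds (α K c : ℝ) (p : ℕ → ℝ) : Prop where
  lower : ∀ i : ℕ, c * ((i:ℝ) + 1) ^ α ≤ p i
  approx : ∀ i : ℕ, |p i - (2 * (i:ℝ) + 2) ^ α| ≤ K * ((i:ℝ) + 1) ^ (α - 1)

lemma WeightAsymp.exists_bounds {w : ℕ → ℝ} {α B : ℝ} (hα : 0 < α) (hw : ∀ n, 0 < w n)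
    (h : WeightAsymp w α B) :
    ∃ K > 0, ∃ c > 0, (∀ n : ℕ, c * ((n:ℝ) + 1) ^ α ≤ 1 / w n) ∧
      ∀ n : ℕ, |1 / w n - ((n:ℝ) + 1) ^ α| ≤ K * ((n:ℝ) + 1) ^ (α - 1) := by
  obtain ⟨C₀, hC₀, N₀, hN⟩ := h
  have hO : (fun n : ℕ => 1 / w n - ((n:ℝ) + 1) ^ α) =O[atTop]
      fun n : ℕ => ((n:ℝ) + 1) ^ (α - 1) := by
    refine Asymptotics.IsBigO.of_bound ((C₀ + 2 * |B|) * 2 + max 1 α * 4 ^ α) ?_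
    filter_upwards [eventually_ge_atTop N₀, eventually_ge_atTop 1] with n hn hn1
    have hn0 : (1:ℝ) ≤ n := by exact_mod_cast hn1
    have hn' : (0:ℝ) < n := by linarith
    have h1 := hN n hn
    have h2 := abs_rpow_sub_rpow_le (α := α) (x := n) (y := n + 1) hα (by linarith) (by linarith)
      (by linarith)
    have h3 : (n:ℝ) ^ (α - 2) ≤ (n:ℝ) ^ (α - 1) :=
      Real.rpow_le_rpow_of_exponent_le hn0 (by linarith)
    have h4 : (n:ℝ) ^ (α - 1) ≤ 2 * ((n:ℝ) + 1) ^ (α - 1) := by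
      rw [Real.rpow_sub_one (by positivity), Real.rpow_sub_one (by positivity), ← mul_div_assoc,
        div_le_div_iff₀ (by positivity) (by positivity)]
      have : (n:ℝ) ^ α ≤ ((n:ℝ) + 1) ^ α := Real.rpow_le_rpow (by positivity) (by linarith) hα.le
      have h0 : (0:ℝ) ≤ (n:ℝ) ^ α := by positivity
      nlinarith
    have hy : 0 ≤ ((n:ℝ) + 1) ^ (α - 1) := by positivity
    rw [Real.norm_eq_abs, Real.norm_of_nonneg hy]
    rw [show (n:ℝ) - (n + 1) = -1 by ring, abs_neg, abs_one, one_mul] at h2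
    have h5 : |2 * B * (n:ℝ) ^ (α - 1)| ≤ 2 * |B| * (n:ℝ) ^ (α - 1) := by
      rw [abs_mul, abs_mul, abs_two, abs_of_nonneg (Real.rpow_nonneg hn'.le _)]
    have h6 : (C₀ + 2 * |B|) * (n:ℝ) ^ (α - 1)
        ≤ (C₀ + 2 * |B|) * (2 * ((n:ℝ) + 1) ^ (α - 1)) := by gcongr
    have h7 : C₀ * (n:ℝ) ^ (α - 2) ≤ C₀ * (n:ℝ) ^ (α - 1) := by gcongr
    rw [abs_le] at *
    constructor <;> linarith [h1.1, h1.2, h2.1, h2.2, h5.1, h5.2]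
  obtain ⟨K, hK, hKb⟩ := Asymptotics.bound_of_isBigO_nat_atTop hO
  have hKb' : ∀ n : ℕ, |1 / w n - ((n:ℝ) + 1) ^ α| ≤ K * ((n:ℝ) + 1) ^ (α - 1) := fun n => by
    have hy : 0 < ((n:ℝ) + 1) ^ (α - 1) := by positivity
    simpa [Real.norm_eq_abs, abs_of_pos hy] using hKb hy.ne'
  have hO2 : (fun n : ℕ => ((n:ℝ) + 1) ^ α) =O[atTop] fun n : ℕ => 1 / w n := by
    refine Asymptotics.IsBigO.of_bound 2 ?_
    filter_upwards [tendsto_natCast_atTop_atTop.eventually_ge_atTop (2 * K)] with n hn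
    have h1 := hKb' n
    have hy : 0 < ((n:ℝ) + 1) ^ α := by positivity
    have hwn : 0 < 1 / w n := by have := hw n; positivity
    rw [Real.norm_of_nonneg hy.le, Real.norm_of_nonneg hwn.le]
    have h2 : K * ((n:ℝ) + 1) ^ (α - 1) ≤ ((n:ℝ) + 1) ^ α / 2 := by
      rw [Real.rpow_sub_one (by positivity), ← mul_div_assoc, div_le_div_iff₀ (by positivity)
        (by positivity)]
      nlinarith
    linarith [(abs_le.1 h1).1]
  obtain ⟨c, hc, hcb⟩ := Asymptotics.bound_of_isBigO_nat_atTop hO2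
  refine ⟨K, hK, c⁻¹, inv_pos.2 hc, fun n => ?_, hKb'⟩
  have hwn : 0 < 1 / w n := by have := hw n; positivity
  have h := hcb hwn.ne'
  rw [Real.norm_of_nonneg (by positivity), Real.norm_of_nonneg hwn.le] at h
  rwa [inv_mul_le_iff₀ hc]

lemma UrnChoice.exists_rateBounds {w b r : ℕ → ℝ} {α B : ℝ} (hα : 0 < α) (hw : ∀ n, 0 < w n)
    (h : WeightAsymp w α B) (hbr : UrnChoice w b r) :
    ∃ K > 0, ∃ c > 0, RateBounds α K c (fun i => 1 / b i) ∧
      RateBounds α K c (fun i => 1 / r i) := by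
  obtain ⟨K, hK, c, hc, hlow, happ⟩ := h.exists_bounds hα hw
  have key : ∀ i m : ℕ, (m = 2 * i ∨ m = 2 * i + 1) →
      c * ((i:ℝ) + 1) ^ α ≤ 1 / w m ∧
      |1 / w m - (2 * (i:ℝ) + 2) ^ α| ≤
        (K * 2 ^ α + max 1 α * 4 ^ α * 2 ^ α) * ((i:ℝ) + 1) ^ (α - 1) := by
    intro i m hm
    have hi : (0:ℝ) ≤ i := by positivity
    have hm1 : 2 * (i:ℝ) ≤ m ∧ (m:ℝ) ≤ 2 * i + 1 := by
      rcases hm with rfl | rfl <;> push_cast <;> constructor <;> linarith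
    obtain ⟨hm1, hm2⟩ := hm1
    refine ⟨le_trans ?_ (hlow m), ?_⟩
    · gcongr; omega
    · have h1 := happ m
      have h2 := abs_rpow_sub_rpow_le (α := α) (x := (m:ℝ) + 1) (y := 2 * i + 2) hα
        (by positivity) (by positivity) (by linarith)
      have h3 := rpow_sub_one_le_of_le_two_mul (α := α) (x := (m:ℝ) + 1) (y := (i:ℝ) + 1) hα
        (by positivity) (by linarith) (by linarith)
      have h4 := rpow_sub_one_le_of_le_two_mul (α := α) (x := 2 * (i:ℝ) + 2) (y := (i:ℝ) + 1) hα
        (by positivity) (by linarith) (by linarith)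
      have h5 : |(m:ℝ) + 1 - (2 * i + 2)| ≤ 1 := by
        rw [abs_le]; constructor <;> linarith
      have h6 : |(m:ℝ) + 1 - (2 * i + 2)| * (2 * (i:ℝ) + 2) ^ (α - 1)
          ≤ 1 * (2 ^ α * ((i:ℝ) + 1) ^ (α - 1)) := by gcongr
      calc |1 / w m - (2 * (i:ℝ) + 2) ^ α|
          ≤ |1 / w m - ((m:ℝ) + 1) ^ α| + |((m:ℝ) + 1) ^ α - (2 * (i:ℝ) + 2) ^ α| :=
            abs_sub_le _ _ _
        _ ≤ K * (2 ^ α * ((i:ℝ) + 1) ^ (α - 1))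
            + max 1 α * 4 ^ α * (1 * (2 ^ α * ((i:ℝ) + 1) ^ (α - 1))) := by
            refine add_le_add (h1.trans (by gcongr)) (h2.trans ?_)
            gcongr
        _ = _ := by ring
  refine ⟨K * 2 ^ α + max 1 α * 4 ^ α * 2 ^ α, by positivity, c, hc, ?_⟩
  rcases hbr with h | h | h <;>
  exact ⟨⟨fun i => by rw [(h i).1]; exact (key i _ (by simp)).1,
      fun i => by rw [(h i).1]; exact (key i _ (by simp)).2⟩,
    ⟨fun i => by rw [(h i).2]; exact (key i _ (by simp)).1,
      fun i => by rw [(h i).2]; exact (key i _ (by simp)).2⟩⟩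

namespace RateBounds

variable {α K c : ℝ} {p q : ℕ → ℝ}

lemma pos (hc : 0 < c) (hp : RateBounds α K c p) (i : ℕ) : 0 < p i :=
  lt_of_lt_of_le (by positivity) (hp.lower i)

lemma upper (hK : 0 < K) (hp : RateBounds α K c p) (i : ℕ) :
    p i ≤ (2 ^ α + K) * ((i:ℝ) + 1) ^ α := by
  have h1 := (abs_le.1 (hp.approx i)).2
  have h2 : ((i:ℝ) + 1) ^ (α - 1) ≤ ((i:ℝ) + 1) ^ α :=
    Real.rpow_le_rpow_of_exponent_le (by linarith [(Nat.cast_nonneg i : (0:ℝ) ≤ i)]) (by linarith)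
  rw [show 2 * (i:ℝ) + 2 = 2 * (i + 1) by ring, Real.mul_rpow (by norm_num) (by positivity)] at h1
  nlinarith

/-- The drift of the discrepancy points towards zero, up to an error of order `1 / n`. -/
lemma drift_le_of_le (hα : 0 < α) (hK : 0 < K) (hc : 0 < c) (hp : RateBounds α K c p)
    (hq : RateBounds α K c q) {i j : ℕ} (hij : i ≤ j) :
    ((j:ℝ) - i) * (p i - q j) ≤ K * (((2 ^ α + K) / c) ^ α⁻¹ + 1) / c * (p i + q j) := by
  have hij' : (i:ℝ) ≤ j := by exact_mod_cast hij
  have hpi := hp.pos hc i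
  have hqj := hq.pos hc j
  rcases le_or_gt (p i) (q j) with h | h
  · have h1 : ((j:ℝ) - i) * (p i - q j) ≤ 0 :=
      mul_nonpos_of_nonneg_of_nonpos (by linarith) (by linarith)
    exact h1.trans (by positivity)
  set T := ((2 ^ α + K) / c) ^ α⁻¹ with hT
  have hT0 : 0 < T := by positivity
  set a : ℝ := i + 1 with ha
  set d : ℝ := j + 1 with hd
  have ha0 : 0 < a := by positivity
  have hd0 : 0 < d := by positivity
  have had : a ≤ d := by linarith
  have hdT : d ≤ T * a := by
    have h1 : d ^ α ≤ (2 ^ α + K) / c * a ^ α := by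
      rw [div_mul_eq_mul_div, le_div_iff₀ hc]
      linarith [hq.lower j, hp.upper hK i]
    have h2 : (d ^ α) ^ α⁻¹ ≤ ((2 ^ α + K) / c * a ^ α) ^ α⁻¹ := by gcongr
    rwa [Real.mul_rpow (by positivity) (by positivity), Real.rpow_rpow_inv hd0.le hα.ne',
      Real.rpow_rpow_inv ha0.le hα.ne'] at h2
  have h1 := (abs_le.1 (hp.approx i)).2
  have h2 := (abs_le.1 (hq.approx j)).1
  have h3 : (2 * (i:ℝ) + 2) ^ α ≤ (2 * (j:ℝ) + 2) ^ α := by gcongr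
  have h4 : p i - q j ≤ K * (a ^ (α - 1) + d ^ (α - 1)) := by linarith
  calc ((j:ℝ) - i) * (p i - q j) ≤ d * (K * (a ^ (α - 1) + d ^ (α - 1))) := by
        apply mul_le_mul _ h4 (by linarith) hd0.le
        linarith [(Nat.cast_nonneg i : (0:ℝ) ≤ i)]
    _ = K * (d * a ^ (α - 1) + d ^ α) := by
        rw [Real.rpow_sub_one hd0.ne']; field_simp
    _ ≤ K * (T * a * a ^ (α - 1) + d ^ α) := by gcongr
    _ = K * (T * a ^ α + d ^ α) := by
        rw [Real.rpow_sub_one ha0.ne']; field_simp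
    _ ≤ K * (T * (p i / c) + q j / c) := by
        gcongr
        · rw [le_div_iff₀ hc, mul_comm]; exact hp.lower i
        · rw [le_div_iff₀ hc, mul_comm]; exact hq.lower j
    _ ≤ K * ((T + 1) * (p i / c) + (T + 1) * (q j / c)) := by
        have h5 : 0 < q j / c := div_pos hqj hc
        gcongr
        · linarith
        · nlinarith
    _ = _ := by ring

lemma exists_drift_le (hα : 0 < α) (hK : 0 < K) (hc : 0 < c) (hp : RateBounds α K c p)
    (hq : RateBounds α K c q) :
    ∃ C > 0, ∀ i j : ℕ, ((j:ℝ) - i) * (p i - q j) ≤ C * (p i + q j) := by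
  refine ⟨K * (((2 ^ α + K) / c) ^ α⁻¹ + 1) / c, by positivity, fun i j => ?_⟩
  rcases le_total i j with h | h
  · exact drift_le_of_le hα hK hc hp hq h
  · have := drift_le_of_le hα hK hc hq hp h
    linarith

lemma exists_abs_sub_rpow_le (hα : 0 < α) (hK : 0 < K) :
    ∃ C > 0, ∀ p : ℕ → ℝ, RateBounds α K c p → ∀ n i : ℕ, 0 < n → i ≤ n →
      |p i - (n:ℝ) ^ α| ≤ C * ((n:ℝ) ^ (α - 1) * (|2 * (i:ℝ) - n| + 1)) := by
  refine ⟨K * (2 * 2 ^ α) + max 1 α * 4 ^ α * 2, by positivity, fun p hp n i hn hin => ?_⟩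
  have hn0 : (0:ℝ) < n := by exact_mod_cast hn
  have hn1 : (1:ℝ) ≤ n := by exact_mod_cast hn
  have hi0 : (0:ℝ) ≤ i := by positivity
  have hin' : (i:ℝ) ≤ n := by exact_mod_cast hin
  have h1 := abs_rpow_sub_rpow_le (α := α) (x := 2 * (i:ℝ) + 2) (y := n) hα (by positivity) hn0
    (by linarith)
  have h2 : |2 * (i:ℝ) + 2 - n| ≤ 2 * (|2 * (i:ℝ) - n| + 1) := by
    rw [abs_le]
    have h := neg_abs_le (2 * (i:ℝ) - n)
    have h' := le_abs_self (2 * (i:ℝ) - n)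
    have h'' := abs_nonneg (2 * (i:ℝ) - n)
    constructor <;> linarith
  have h3 : ((i:ℝ) + 1) ^ (α - 1) ≤ 2 * 2 ^ α * ((n:ℝ) ^ (α - 1) * (|2 * (i:ℝ) - n| + 1)) := by
    have h4 : ((i:ℝ) + 1) ^ α ≤ 2 ^ α * (n:ℝ) ^ α := by
      rw [← Real.mul_rpow (by norm_num) hn0.le]
      gcongr
      linarith
    have h5 : (n:ℝ) ≤ 2 * ((i:ℝ) + 1) * (|2 * (i:ℝ) - n| + 1) := by
      have h := neg_abs_le (2 * (i:ℝ) - n)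
      nlinarith [abs_nonneg (2 * (i:ℝ) - n)]
    rw [Real.rpow_sub_one hn0.ne', Real.rpow_sub_one (by positivity), div_le_iff₀ (by positivity)]
    calc ((i:ℝ) + 1) ^ α ≤ 2 ^ α * (n:ℝ) ^ α / n * n := by rwa [div_mul_cancel₀ _ hn0.ne']
      _ ≤ 2 ^ α * (n:ℝ) ^ α / n * (2 * ((i:ℝ) + 1) * (|2 * (i:ℝ) - n| + 1)) := by gcongr
      _ = _ := by ring
  calc |p i - (n:ℝ) ^ α|
      ≤ |p i - (2 * (i:ℝ) + 2) ^ α| + |(2 * (i:ℝ) + 2) ^ α - (n:ℝ) ^ α| := abs_sub_le _ _ _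
    _ ≤ K * (2 * 2 ^ α * ((n:ℝ) ^ (α - 1) * (|2 * (i:ℝ) - n| + 1)))
        + max 1 α * 4 ^ α * (2 * (|2 * (i:ℝ) - n| + 1) * (n:ℝ) ^ (α - 1)) := by
      refine add_le_add ((hp.approx i).trans (by gcongr)) (h1.trans (by gcongr))
    _ = _ := by ring

/-- The difference of the partial sums is `n ^ α` times the discrepancy, up to lower order. -/
lemma exists_abs_sum_sub_le (hα : 0 < α) (hK : 0 < K) (hp : RateBounds α K c p)
    (hq : RateBounds α K c q) :
    ∃ C > 0, ∀ n i j : ℕ, 0 < n → i + j = n →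
      |(∑ k ∈ Finset.range j, q k - ∑ k ∈ Finset.range i, p k) / (n:ℝ) ^ α - ((j:ℝ) - i)|
        ≤ C * (((j:ℝ) - i) ^ 2 / n + 1) := by
  obtain ⟨C, hC, hCb⟩ := exists_abs_sub_rpow_le (c := c) hα hK
  have hmin : 0 < min 1 α := lt_min one_pos hα
  have key : ∀ p q : ℕ → ℝ, RateBounds α K c p → RateBounds α K c q → ∀ n i j : ℕ, 0 < n →
      i + j = n → i ≤ j →
      |(∑ k ∈ Finset.range j, q k - ∑ k ∈ Finset.range i, p k) / (n:ℝ) ^ α - ((j:ℝ) - i)|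
        ≤ (2 * C + 2 * K * (min 1 α)⁻¹) * (((j:ℝ) - i) ^ 2 / n + 1) := by
    intro p q hp hq n i j hn hij hle
    have hn0 : (0:ℝ) < n := by exact_mod_cast hn
    have hna : (0:ℝ) < (n:ℝ) ^ α := by positivity
    have hnij : (n:ℝ) = i + j := by rw [← hij]; push_cast; ring
    have hle' : (i:ℝ) ≤ j := by exact_mod_cast hle
    have h1 : |∑ k ∈ Finset.Ico i j, (q k - (n:ℝ) ^ α)|
        ≤ C * ((n:ℝ) ^ (α - 1) * (2 * ((j:ℝ) - i) ^ 2)) := by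
      have h2 : ∀ k ∈ Finset.Ico i j,
          |q k - (n:ℝ) ^ α| ≤ C * ((n:ℝ) ^ (α - 1) * (((j:ℝ) - i) + 1)) := by
        intro k hk
        obtain ⟨hk1, hk2⟩ := Finset.mem_Ico.1 hk
        have hk1' : (i:ℝ) ≤ k := by exact_mod_cast hk1
        have hk2' : (k:ℝ) ≤ j := by exact_mod_cast hk2.le
        refine (hCb q hq n k hn (by omega)).trans ?_
        gcongr
        rw [abs_le]
        constructor <;> linarith
      calc |∑ k ∈ Finset.Ico i j, (q k - (n:ℝ) ^ α)|
          ≤ ∑ k ∈ Finset.Ico i j, |q k - (n:ℝ) ^ α| := Finset.abs_sum_le_sum_abs _ _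
        _ ≤ (Finset.Ico i j).card • (C * ((n:ℝ) ^ (α - 1) * (((j:ℝ) - i) + 1))) :=
          Finset.sum_le_card_nsmul _ _ _ h2
        _ = C * ((n:ℝ) ^ (α - 1) * (((j:ℝ) - i) * (((j:ℝ) - i) + 1))) := by
          rw [Nat.card_Ico, nsmul_eq_mul, Nat.cast_sub hle]; ring
        _ ≤ _ := by
          have h3 : ((j:ℝ) - i) ≤ ((j:ℝ) - i) ^ 2 := by
            rw [← Nat.cast_sub hle]
            exact_mod_cast Nat.le_self_pow two_ne_zero (j - i)
          have h4 : ((j:ℝ) - i) * (((j:ℝ) - i) + 1) ≤ 2 * ((j:ℝ) - i) ^ 2 := by linarith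
          gcongr
    have h4 : |∑ k ∈ Finset.range i, (q k - p k)| ≤ 2 * K * ((min 1 α)⁻¹ * (n:ℝ) ^ α) := by
      calc |∑ k ∈ Finset.range i, (q k - p k)|
          ≤ ∑ k ∈ Finset.range i, |q k - p k| := Finset.abs_sum_le_sum_abs _ _
        _ ≤ ∑ k ∈ Finset.range i, 2 * K * ((k:ℝ) + 1) ^ (α - 1) := by
          refine Finset.sum_le_sum fun k _ => ?_
          have h5 := abs_sub_le (q k) ((2 * (k:ℝ) + 2) ^ α) (p k)
          have h6 := hp.approx k
          rw [abs_sub_comm] at h6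
          linarith [hq.approx k]
        _ ≤ 2 * K * ((min 1 α)⁻¹ * (i:ℝ) ^ α) := by
          rw [← Finset.mul_sum]
          gcongr
          exact sum_rpow_sub_one_le hα i
        _ ≤ _ := by
          gcongr
          omega
    have h7 : ∑ k ∈ Finset.range j, q k - ∑ k ∈ Finset.range i, p k
        = (∑ k ∈ Finset.Ico i j, (q k - (n:ℝ) ^ α) + (∑ k ∈ Finset.range i, (q k - p k)))
          + (n:ℝ) ^ α * ((j:ℝ) - i) := by
      rw [← Finset.sum_range_add_sum_Ico q hle, Finset.sum_sub_distrib, Finset.sum_sub_distrib,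
        Finset.sum_const, Nat.card_Ico, nsmul_eq_mul, Nat.cast_sub hle]
      ring
    rw [h7, add_div, mul_div_cancel_left₀ _ hna.ne', add_sub_cancel_right, abs_div,
      abs_of_pos hna, div_le_iff₀ hna]
    refine (abs_add_le _ _).trans ((add_le_add h1 h4).trans ?_)
    rw [Real.rpow_sub_one hn0.ne']
    have h8 : 0 ≤ 2 * C * (n:ℝ) ^ α := by positivity
    have h9 : 0 ≤ 2 * K * (min 1 α)⁻¹ * (((j:ℝ) - i) ^ 2 / n) * (n:ℝ) ^ α := by positivity
    calc _ = 2 * C * (((j:ℝ) - i) ^ 2 / n) * (n:ℝ) ^ α + 2 * K * (min 1 α)⁻¹ * (n:ℝ) ^ α := by ring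
      _ ≤ _ := by linarith
  refine ⟨2 * C + 2 * K * (min 1 α)⁻¹, by positivity, fun n i j hn hij => ?_⟩
  rcases le_total i j with h | h
  · exact key p q hp hq n i j hn hij h
  · have := key q p hq hp n j i hn (by omega) h
    rw [← abs_neg]
    rw [show ((j:ℝ) - i) ^ 2 = ((i:ℝ) - j) ^ 2 by ring]
    convert this using 2
    ring

/-- The conditional second moment of the martingale increments is close to `n ^ (2 α)`. -/
lemma exists_abs_mul_sub_le (hα : 0 < α) (hK : 0 < K) (hc : 0 < c) (hp : RateBounds α K c p)
    (hq : RateBounds α K c q) :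
    ∃ C > 0, ∀ n i j : ℕ, 0 < n → i + j = n →
      |p i * q j / (n:ℝ) ^ (2 * α) - 1| ≤ C * ((|(j:ℝ) - i| + 1) / n) := by
  obtain ⟨C, hC, hCb⟩ := exists_abs_sub_rpow_le (c := c) hα hK
  refine ⟨C * ((2 ^ α + K) * 2 ^ α) + C, by positivity, fun n i j hn hij => ?_⟩
  have hn0 : (0:ℝ) < n := by exact_mod_cast hn
  have hn1 : (1:ℝ) ≤ n := by exact_mod_cast hn
  have hna : (0:ℝ) < (n:ℝ) ^ α := by positivity
  have hnij : (n:ℝ) = i + j := by rw [← hij]; push_cast; ring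
  have h1 := hCb p hp n i hn (by omega)
  have h2 := hCb q hq n j hn (by omega)
  rw [show 2 * (i:ℝ) - n = -((j:ℝ) - i) by rw [hnij]; ring, abs_neg] at h1
  rw [show 2 * (j:ℝ) - n = (j:ℝ) - i by rw [hnij]; ring] at h2
  rw [Real.rpow_sub_one hn0.ne'] at h1 h2
  have h3 : q j ≤ (2 ^ α + K) * 2 ^ α * (n:ℝ) ^ α := by
    refine (hq.upper hK j).trans ?_
    rw [mul_assoc, ← Real.mul_rpow (by norm_num) hn0.le]
    have : (0:ℝ) ≤ i := by positivity
    gcongr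
    linarith
  have hqj := hq.pos hc j
  rw [show 2 * α = α + α by ring, Real.rpow_add hn0, div_sub_one (by positivity), abs_div,
    abs_of_pos (mul_pos hna hna), div_le_iff₀ (by positivity)]
  calc |p i * q j - (n:ℝ) ^ α * (n:ℝ) ^ α|
      = |(p i - (n:ℝ) ^ α) * q j + (n:ℝ) ^ α * (q j - (n:ℝ) ^ α)| := by congr 1; ring
    _ ≤ |p i - (n:ℝ) ^ α| * q j + (n:ℝ) ^ α * |q j - (n:ℝ) ^ α| := by
      refine (abs_add_le _ _).trans_eq ?_
      rw [abs_mul, abs_mul, abs_of_pos hqj, abs_of_pos hna]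
    _ ≤ C * ((n:ℝ) ^ α / n * (|(j:ℝ) - i| + 1)) * ((2 ^ α + K) * 2 ^ α * (n:ℝ) ^ α)
        + (n:ℝ) ^ α * (C * ((n:ℝ) ^ α / n * (|(j:ℝ) - i| + 1))) := by gcongr
    _ = _ := by ring

end RateBounds

namespace Urn

variable {Ω : Type*} [MeasurableSpace Ω] {μ : Measure Ω} {b r : ℕ → ℝ}

lemma Bl_add_Re (U : Urn μ b r) (n : ℕ) (ω : Ω) : U.Bl n ω + U.Re n ω = n := by
  induction n with
  | zero => simp [U.init_Bl, U.init_Re]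
  | succ n ih => rcases U.step n ω with ⟨h1, h2⟩ | ⟨h1, h2⟩ <;> omega

lemma measurable_F_comp (U : Urn μ b r) (n : ℕ) (f : ℕ → ℕ → ℝ) :
    Measurable[U.F n] fun ω => f (U.Bl n ω) (U.Re n ω) := by
  have h : Measurable[U.F n] fun ω => (U.Bl n ω, U.Re n ω) := by
    rw [measurable_iff_comap_le]
    exact le_iSup₂_of_le (f := fun j (_ : j ∈ Set.Iic n) =>
      MeasurableSpace.comap (fun ω => (U.Bl j ω, U.Re j ω)) inferInstance) n Set.self_mem_Iic le_rfl
  exact (measurable_of_countable fun x : ℕ × ℕ => f x.1 x.2).comp h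

lemma F_le (U : Urn μ b r) (n : ℕ) : U.F n ≤ ‹MeasurableSpace Ω› :=
  iSup₂_le fun j _ => ((U.meas_Bl j).prodMk (U.meas_Re j)).comap_le

lemma measurable_comp (U : Urn μ b r) (n : ℕ) (f : ℕ → ℕ → ℝ) :
    Measurable fun ω => f (U.Bl n ω) (U.Re n ω) :=
  (U.measurable_F_comp n f).mono (U.F_le n) le_rfl

lemma exists_bound (U : Urn μ b r) (n : ℕ) (f : ℕ → ℕ → ℝ) :
    ∃ C, ∀ ω, ‖f (U.Bl n ω) (U.Re n ω)‖ ≤ C := by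
  refine ⟨∑ x ∈ Finset.range (n + 1) ×ˢ Finset.range (n + 1), ‖f x.1 x.2‖, fun ω => ?_⟩
  have h := U.Bl_add_Re n ω
  exact Finset.single_le_sum (f := fun x : ℕ × ℕ => ‖f x.1 x.2‖) (fun x _ => norm_nonneg _)
    (a := (U.Bl n ω, U.Re n ω))
    (Finset.mem_product.2 ⟨Finset.mem_range.2 (by simp; omega), Finset.mem_range.2 (by simp; omega)⟩)

/-- The expectation of a function of the state after `n` draws. -/
noncomputable def expect (U : Urn μ b r) (n : ℕ) (f : ℕ → ℕ → ℝ) : ℝ :=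
  ∫ ω, f (U.Bl n ω) (U.Re n ω) ∂μ

lemma expect_congr (U : Urn μ b r) (n : ℕ) {f g : ℕ → ℕ → ℝ}
    (h : ∀ i j, i + j = n → f i j = g i j) : U.expect n f = U.expect n g :=
  integral_congr_ae (ae_of_all _ fun ω => h _ _ (U.Bl_add_Re n ω))

lemma expect_const_mul (U : Urn μ b r) (n : ℕ) (a : ℝ) (f : ℕ → ℕ → ℝ) :
    (U.expect n fun i j => a * f i j) = a * U.expect n f :=
  integral_const_mul _ _

lemma expect_div_const (U : Urn μ b r) (n : ℕ) (f : ℕ → ℕ → ℝ) (a : ℝ) :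
    (U.expect n fun i j => f i j / a) = U.expect n f / a :=
  integral_div _ _

lemma abs_expect_le (U : Urn μ b r) (n : ℕ) (f : ℕ → ℕ → ℝ) :
    |U.expect n f| ≤ U.expect n fun i j => |f i j| :=
  abs_integral_le_integral_abs

variable [IsProbabilityMeasure μ]

lemma integrable_comp (U : Urn μ b r) (n : ℕ) (f : ℕ → ℕ → ℝ) :
    Integrable (fun ω => f (U.Bl n ω) (U.Re n ω)) μ := by
  obtain ⟨C, hC⟩ := U.exists_bound n f
  exact .of_bound (U.measurable_comp n f).aestronglyMeasurable C (ae_of_all _ hC)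

lemma expect_mono (U : Urn μ b r) (n : ℕ) {f g : ℕ → ℕ → ℝ}
    (h : ∀ i j, i + j = n → f i j ≤ g i j) : U.expect n f ≤ U.expect n g :=
  integral_mono (U.integrable_comp n f) (U.integrable_comp n g)
    fun ω => h _ _ (U.Bl_add_Re n ω)

lemma expect_const (U : Urn μ b r) (n : ℕ) (a : ℝ) : (U.expect n fun _ _ => a) = a := by
  simp [expect]

lemma expect_add (U : Urn μ b r) (n : ℕ) (f g : ℕ → ℕ → ℝ) :
    (U.expect n fun i j => f i j + g i j) = U.expect n f + U.expect n g :=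
  integral_add (U.integrable_comp n f) (U.integrable_comp n g)

lemma expect_sub (U : Urn μ b r) (n : ℕ) (f g : ℕ → ℕ → ℝ) :
    (U.expect n fun i j => f i j - g i j) = U.expect n f - U.expect n g :=
  integral_sub (U.integrable_comp n f) (U.integrable_comp n g)

lemma expect_zero_time (U : Urn μ b r) (f : ℕ → ℕ → ℝ) : U.expect 0 f = f 0 0 := by
  simp [expect, U.init_Bl, U.init_Re]

/-- The one-step evolution of expectations. -/
lemma expect_succ (U : Urn μ b r) (hb : ∀ i, 0 < b i) (hr : ∀ i, 0 < r i) (n : ℕ)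
    (f : ℕ → ℕ → ℝ) :
    U.expect (n + 1) f =
      U.expect n fun i j => (b i * f (i + 1) j + r j * f i (j + 1)) / (b i + r j) := by
  set I : Ω → ℝ := fun ω => if U.Bl (n + 1) ω = U.Bl n ω + 1 then (1:ℝ) else 0 with hI
  set g : ℕ → ℕ → ℝ := fun i j => f (i + 1) j - f i (j + 1) with hg
  have hImeas : Measurable I :=
    Measurable.ite (measurableSet_eq_fun (U.meas_Bl (n + 1)) ((U.meas_Bl n).add_const 1))
      measurable_const measurable_const
  have hIint : Integrable I μ := .of_bound hImeas.aestronglyMeasurable 1 (ae_of_all _ fun ω => by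
    simp only [hI]; split_ifs <;> simp)
  have hgI : Integrable (fun ω => g (U.Bl n ω) (U.Re n ω) * I ω) μ := by
    obtain ⟨C, hC⟩ := U.exists_bound n g
    exact hIint.bdd_mul (U.measurable_comp n g).aestronglyMeasurable (ae_of_all _ hC)
  have hsplit : ∀ ω, f (U.Bl (n + 1) ω) (U.Re (n + 1) ω) =
      f (U.Bl n ω) (U.Re n ω + 1) + g (U.Bl n ω) (U.Re n ω) * I ω := by
    intro ω
    rcases U.step n ω with ⟨h1, h2⟩ | ⟨h1, h2⟩ <;> simp [hI, hg, h1, h2]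
  have hpull : ∫ ω, g (U.Bl n ω) (U.Re n ω) * I ω ∂μ =
      U.expect n fun i j => g i j * (b i / (b i + r j)) := by
    rw [← integral_condExp (U.F_le n)]
    refine integral_congr_ae ?_
    have h1 := condExp_mul_of_stronglyMeasurable_left (m := U.F n) (μ := μ)
      (U.measurable_F_comp n g).stronglyMeasurable hgI hIint
    filter_upwards [h1, U.markov n] with ω hω1 hω2
    refine hω1.trans ?_
    simp only [Pi.mul_apply]
    congr 1
  have hsum : U.expect (n + 1) f =
      (U.expect n fun i j => f i (j + 1)) + U.expect n fun i j => g i j * (b i / (b i + r j)) := by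
    rw [← hpull]
    simp only [expect, hsplit]
    exact integral_add (U.integrable_comp n fun i j => f i (j + 1)) hgI
  rw [hsum, ← expect_add]
  refine U.expect_congr n fun i j _ => ?_
  have := hb i
  have := hr j
  simp only [hg]
  field_simp
  ring


section Martingale

/-- The difference of the accumulated inverse weights; along the urn process, a martingale. -/
noncomputable def weightDiff (b r : ℕ → ℝ) (i j : ℕ) : ℝ :=
  ∑ k ∈ Finset.range j, 1 / r k - ∑ k ∈ Finset.range i, 1 / b k

lemma weightDiff_succ_left (b r : ℕ → ℝ) (i j : ℕ) :
    weightDiff b r (i + 1) j = weightDiff b r i j - 1 / b i := by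
  simp only [weightDiff, Finset.sum_range_succ]; ring

lemma weightDiff_succ_right (b r : ℕ → ℝ) (i j : ℕ) :
    weightDiff b r i (j + 1) = weightDiff b r i j + 1 / r j := by
  simp only [weightDiff, Finset.sum_range_succ]; ring

lemma expect_weightDiff (U : Urn μ b r) (hb : ∀ i, 0 < b i) (hr : ∀ i, 0 < r i) (n : ℕ) :
    U.expect n (weightDiff b r) = 0 := by
  induction n with
  | zero => simp [expect_zero_time, weightDiff]
  | succ n ih =>
    rw [U.expect_succ hb hr, ← ih]
    refine U.expect_congr n fun i j _ => ?_
    have := hb i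
    have := hr j
    rw [weightDiff_succ_left, weightDiff_succ_right]
    field_simp
    ring

lemma expect_weightDiff_sq (U : Urn μ b r) (hb : ∀ i, 0 < b i) (hr : ∀ i, 0 < r i) (n : ℕ) :
    (U.expect n fun i j => weightDiff b r i j ^ 2) =
      ∑ k ∈ Finset.range n, U.expect k fun i j => 1 / b i * (1 / r j) := by
  induction n with
  | zero => simp [expect_zero_time, weightDiff]
  | succ n ih =>
    rw [U.expect_succ hb hr, Finset.sum_range_succ, ← ih, ← expect_add]
    refine U.expect_congr n fun i j _ => ?_
    have := hb i
    have := hr j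
    rw [weightDiff_succ_left, weightDiff_succ_right]
    field_simp
    ring

end Martingale

section Moments

variable {α K c : ℝ}

lemma exists_discrepancy_drift_le (hα : 0 < α) (hK : 0 < K) (hc : 0 < c)
    (hp : RateBounds α K c fun i => 1 / b i) (hq : RateBounds α K c fun i => 1 / r i)
    (hb : ∀ i, 0 < b i) (hr : ∀ i, 0 < r i) :
    ∃ C > 0, ∀ i j : ℕ, ((j:ℝ) - i) * ((r j - b i) / (b i + r j)) ≤ C := by
  obtain ⟨C, hC, h⟩ := hp.exists_drift_le hα hK hc hq
  refine ⟨C, hC, fun i j => ?_⟩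
  have hbi := hb i
  have hrj := hr j
  have h1 := mul_le_mul_of_nonneg_right (h i j) (mul_pos hbi hrj).le
  rw [← mul_div_assoc, div_le_iff₀ (by positivity)]
  calc ((j:ℝ) - i) * (r j - b i) = ((j:ℝ) - i) * (1 / b i - 1 / r j) * (b i * r j) := by
        field_simp
    _ ≤ _ := h1
    _ = _ := by field_simp; ring

lemma exists_moment_bounds (hα : 0 < α) (hK : 0 < K) (hc : 0 < c)
    (hp : RateBounds α K c fun i => 1 / b i) (hq : RateBounds α K c fun i => 1 / r i)
    (hb : ∀ i, 0 < b i) (hr : ∀ i, 0 < r i) (U : Urn μ b r) :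
    ∃ C > 0, ∀ n : ℕ, (U.expect n fun i j => ((j:ℝ) - i) ^ 2) ≤ C * n ∧
      (U.expect n fun i j => ((j:ℝ) - i) ^ 4) ≤ C * (n:ℝ) ^ 2 := by
  obtain ⟨C, hC, h⟩ := exists_discrepancy_drift_le hα hK hc hp hq hb hr
  have h2 : ∀ n : ℕ, (U.expect n fun i j => ((j:ℝ) - i) ^ 2) ≤ (2 * C + 1) * n := by
    intro n
    induction n with
    | zero => simp [expect_zero_time]
    | succ n ih =>
      have h3 : (U.expect (n + 1) fun i j => ((j:ℝ) - i) ^ 2) ≤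
          U.expect n fun i j => ((j:ℝ) - i) ^ 2 + (2 * C + 1) := by
        rw [U.expect_succ hb hr]
        refine U.expect_mono n fun i j _ => ?_
        have hbi := hb i
        have hrj := hr j
        calc _ = ((j:ℝ) - i) ^ 2 + (2 * (((j:ℝ) - i) * ((r j - b i) / (b i + r j))) + 1) := by
              push_cast
              field_simp
              ring
          _ ≤ _ := by linarith [h i j]
      rw [expect_add, expect_const] at h3
      push_cast
      linarith
  set A := (6 + 4 * C) * (2 * C + 1) + (1 + 4 * C) with hA
  have h4 : ∀ n : ℕ, (U.expect n fun i j => ((j:ℝ) - i) ^ 4) ≤ A * (n:ℝ) ^ 2 := by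
    intro n
    induction n with
    | zero => simp [expect_zero_time]
    | succ n ih =>
      have h3 : (U.expect (n + 1) fun i j => ((j:ℝ) - i) ^ 4) ≤
          U.expect n fun i j => (((j:ℝ) - i) ^ 4 + (6 + 4 * C) * ((j:ℝ) - i) ^ 2)
            + (1 + 4 * C) := by
        rw [U.expect_succ hb hr]
        refine U.expect_mono n fun i j _ => ?_
        have hbi := hb i
        have hrj := hr j
        calc _ = ((j:ℝ) - i) ^ 4 + 6 * ((j:ℝ) - i) ^ 2 + 1 + 4 * (((j:ℝ) - i) ^ 2 + 1) *
                (((j:ℝ) - i) * ((r j - b i) / (b i + r j))) := by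
              push_cast
              field_simp
              ring
          _ ≤ ((j:ℝ) - i) ^ 4 + 6 * ((j:ℝ) - i) ^ 2 + 1 + 4 * (((j:ℝ) - i) ^ 2 + 1) * C := by
              gcongr
              exact h i j
          _ = _ := by ring
      rw [expect_add, expect_add, expect_const, expect_const_mul] at h3
      have h5 := mul_le_mul_of_nonneg_left (h2 n) (by positivity : 0 ≤ 6 + 4 * C)
      have hn : (0:ℝ) ≤ n := by positivity
      have hAC : 0 ≤ (1 + 4 * C) * (n:ℝ) := by positivity
      have hAn : 0 ≤ A * (n:ℝ) := by positivity
      have hA1 : (6 + 4 * C) * (2 * C + 1) ≥ 0 := by positivity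
      push_cast
      calc _ ≤ _ := h3
        _ ≤ A * (n:ℝ) ^ 2 + (6 + 4 * C) * ((2 * C + 1) * n) + (1 + 4 * C) := by linarith
        _ = A * (n:ℝ) ^ 2 + (A * n - (1 + 4 * C) * n) + (1 + 4 * C) := by rw [hA]; ring
        _ ≤ A * ((n:ℝ) + 1) ^ 2 := by
          have : 1 + 4 * C ≤ A := by linarith
          linarith
  refine ⟨max (2 * C + 1) A, by positivity, fun n => ⟨(h2 n).trans ?_, (h4 n).trans ?_⟩⟩
  · gcongr; exact le_max_left _ _
  · gcongr; exact le_max_right _ _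

lemma abs_le_sqrt_add {s : ℝ} (hs : 0 < s) (x : ℝ) : |x| ≤ s + x ^ 2 / s := by
  have h : |x| * s ≤ s ^ 2 + x ^ 2 := by nlinarith [sq_nonneg (|x| - s), sq_abs x, abs_nonneg x]
  calc |x| = |x| * s / s := by field_simp
    _ ≤ (s ^ 2 + x ^ 2) / s := by gcongr
    _ = _ := by field_simp

lemma tendsto_expect_weightDiff_sq (hα : 0 < α) (hK : 0 < K) (hc : 0 < c)
    (hp : RateBounds α K c fun i => 1 / b i) (hq : RateBounds α K c fun i => 1 / r i)
    (hb : ∀ i, 0 < b i) (hr : ∀ i, 0 < r i) (U : Urn μ b r) :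
    Tendsto (fun n : ℕ => (U.expect n fun i j => weightDiff b r i j ^ 2) / (n:ℝ) ^ (2 * α + 1))
      atTop (nhds (1 / (2 * α + 1))) := by
  obtain ⟨C, hC, hmom⟩ := exists_moment_bounds hα hK hc hp hq hb hr U
  obtain ⟨C', hC', hprod⟩ := hp.exists_abs_mul_sub_le hα hK hc hq
  simp_rw [U.expect_weightDiff_sq hb hr]
  refine tendsto_sum_div_rpow (by positivity) ?_
  rw [tendsto_iff_dist_tendsto_zero]
  have hlim : Tendsto (fun n : ℕ => C' * (2 + C) / √(n:ℝ)) atTop (nhds 0) :=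
    tendsto_const_nhds.div_atTop (Real.tendsto_sqrt_atTop.comp tendsto_natCast_atTop_atTop)
  refine squeeze_zero' (Eventually.of_forall fun _ => dist_nonneg) ?_ hlim
  filter_upwards [eventually_ge_atTop 1] with n hn
  have hn1 : (1:ℝ) ≤ n := by exact_mod_cast hn
  set s := √(n:ℝ) with hs
  have hs1 : 1 ≤ s := Real.one_le_sqrt.2 hn1
  have hsn : (n:ℝ) = s ^ 2 := (Real.sq_sqrt (by positivity)).symm
  have h1 := U.expect_sub n (fun i j => 1 / b i * (1 / r j) / (n:ℝ) ^ (2 * α)) fun _ _ => 1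
  rw [expect_const, expect_div_const] at h1
  rw [Real.dist_eq, ← h1]
  calc _ ≤ _ := U.abs_expect_le n _
    _ ≤ U.expect n fun i j => C' / n * ((s + 1) + ((j:ℝ) - i) ^ 2 / s) := by
      refine U.expect_mono n fun i j hij => (hprod n i j hn hij).trans ?_
      have := abs_le_sqrt_add (by linarith : 0 < s) ((j:ℝ) - i)
      calc _ ≤ C' * ((s + ((j:ℝ) - i) ^ 2 / s + 1) / n) := by gcongr
        _ = _ := by ring
    _ = C' / n * ((s + 1) + (U.expect n fun i j => ((j:ℝ) - i) ^ 2) / s) := by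
      rw [expect_const_mul, expect_add, expect_const, expect_div_const]
    _ ≤ C' / n * ((s + s) + (C * n) / s) := by
      gcongr
      exact (hmom n).1
    _ = _ := by
      rw [hsn]; field_simp; ring

lemma exists_abs_expect_discrepancy_le (hα : 0 < α) (hK : 0 < K) (hc : 0 < c)
    (hp : RateBounds α K c fun i => 1 / b i) (hq : RateBounds α K c fun i => 1 / r i)
    (hb : ∀ i, 0 < b i) (hr : ∀ i, 0 < r i) (U : Urn μ b r) :
    ∃ C > 0, ∀ n : ℕ, 0 < n → |U.expect n fun i j => (j:ℝ) - i| ≤ C := by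
  obtain ⟨C, hC, hmom⟩ := exists_moment_bounds hα hK hc hp hq hb hr U
  obtain ⟨C', hC', hM⟩ := hp.exists_abs_sum_sub_le hα hK hq
  refine ⟨C' * (C + 1), by positivity, fun n hn => ?_⟩
  have hn0 : (0:ℝ) < n := by exact_mod_cast hn
  have h1 := U.expect_sub n (fun i j => weightDiff b r i j / (n:ℝ) ^ α) fun i j => (j:ℝ) - i
  rw [expect_div_const, U.expect_weightDiff hb hr, zero_div, zero_sub] at h1
  rw [← abs_neg, ← h1]
  calc _ ≤ _ := U.abs_expect_le n _
    _ ≤ U.expect n fun i j => C' * (((j:ℝ) - i) ^ 2 / n + 1) :=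
      U.expect_mono n fun i j hij => hM n i j hn hij
    _ = C' * ((U.expect n fun i j => ((j:ℝ) - i) ^ 2) / n + 1) := by
      rw [expect_const_mul, expect_add, expect_const, expect_div_const]
    _ ≤ C' * (C * n / n + 1) := by
      gcongr
      exact (hmom n).1
    _ = _ := by field_simp

lemma exists_abs_expect_sq_sub_le (hα : 0 < α) (hK : 0 < K) (hc : 0 < c)
    (hp : RateBounds α K c fun i => 1 / b i) (hq : RateBounds α K c fun i => 1 / r i)
    (hb : ∀ i, 0 < b i) (hr : ∀ i, 0 < r i) (U : Urn μ b r) :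
    ∃ C > 0, ∀ n : ℕ, 0 < n →
      |(U.expect n fun i j => ((j:ℝ) - i) ^ 2)
        - (U.expect n fun i j => weightDiff b r i j ^ 2) / (n:ℝ) ^ (2 * α)| ≤ C * √(n:ℝ) := by
  obtain ⟨C, hC, hmom⟩ := exists_moment_bounds hα hK hc hp hq hb hr U
  obtain ⟨C', hC', hM⟩ := hp.exists_abs_sum_sub_le hα hK hq
  refine ⟨C' * (4 * C + 2 * C + 2 + 2 * C' * C + 2 * C'), by positivity, fun n hn => ?_⟩
  have hn1 : (1:ℝ) ≤ n := by exact_mod_cast hn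
  set s := √(n:ℝ) with hs
  have hs1 : 1 ≤ s := Real.one_le_sqrt.2 hn1
  have hs0 : 0 < s := by linarith
  have hsn : (n:ℝ) = s ^ 2 := (Real.sq_sqrt (by positivity)).symm
  rw [← expect_div_const, ← expect_sub]
  calc _ ≤ _ := U.abs_expect_le n _
    _ ≤ U.expect n fun i j => C' * (4 / s * ((j:ℝ) - i) ^ 2 +
        ((2 / s ^ 3 + 2 * C' / s ^ 4) * ((j:ℝ) - i) ^ 4 + (2 * s + 2 * C'))) := by
      refine U.expect_mono n fun i j hij => ?_
      have h1 : |weightDiff b r i j / (n:ℝ) ^ α - ((j:ℝ) - i)|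
        ≤ C' * (((j:ℝ) - i) ^ 2 / n + 1) := hM n i j hn hij
      set d := (j:ℝ) - i
      set Y := weightDiff b r i j / (n:ℝ) ^ α with hY
      have h2 : weightDiff b r i j ^ 2 / (n:ℝ) ^ (2 * α) = Y ^ 2 := by
        rw [hY, div_pow, mul_comm 2 α, Real.rpow_mul (by positivity), Real.rpow_two]
      have h3 := abs_le_sqrt_add hs0 d
      rw [hsn] at h1
      rw [h2]
      calc |d ^ 2 - Y ^ 2| = |Y - d| * |2 * d + (Y - d)| := by
            rw [← abs_mul, ← abs_neg]; congr 1; ring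
        _ ≤ |Y - d| * (2 * |d| + |Y - d|) := by
            gcongr
            exact (abs_add_le _ _).trans_eq (by rw [abs_mul, abs_two])
        _ ≤ C' * (d ^ 2 / s ^ 2 + 1) *
            (2 * (s + d ^ 2 / s) + C' * (d ^ 2 / s ^ 2 + 1)) := by gcongr
        _ = C' * (4 / s * d ^ 2 + ((2 / s ^ 3 + C' / s ^ 4) * d ^ 4 + (2 * s + C'))
              + C' * (2 * (d ^ 2 / s ^ 2))) := by field_simp; ring
        _ ≤ C' * (4 / s * d ^ 2 + ((2 / s ^ 3 + C' / s ^ 4) * d ^ 4 + (2 * s + C'))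
              + C' * ((d ^ 2 / s ^ 2) ^ 2 + 1)) := by
            gcongr
            nlinarith [sq_nonneg (d ^ 2 / s ^ 2 - 1)]
        _ = _ := by field_simp; ring
    _ = C' * (4 / s * (U.expect n fun i j => ((j:ℝ) - i) ^ 2) +
        ((2 / s ^ 3 + 2 * C' / s ^ 4) * (U.expect n fun i j => ((j:ℝ) - i) ^ 4)
          + (2 * s + 2 * C'))) := by
      rw [expect_const_mul, expect_add, expect_add, expect_const, expect_const_mul,
        expect_const_mul]
    _ ≤ C' * (4 / s * (C * n) + ((2 / s ^ 3 + 2 * C' / s ^ 4) * (C * (n:ℝ) ^ 2)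
          + (2 * s + 2 * C'))) := by
      gcongr
      · exact (hmom n).1
      · exact (hmom n).2
    _ = C' * (4 * C * s + (2 * C * s + 2 * C' * C * 1 + (2 * s + 2 * C' * 1))) := by
      rw [hsn]; field_simp
    _ ≤ C' * (4 * C * s + (2 * C * s + 2 * C' * C * s + (2 * s + 2 * C' * s))) := by gcongr
    _ = _ := by ring

end Moments

lemma variance_D (U : Urn μ b r) (n : ℕ) :
    variance (fun ω => (U.D n ω : ℝ)) μ =
      (U.expect n fun i j => ((j:ℝ) - i) ^ 2) - (U.expect n fun i j => (j:ℝ) - i) ^ 2 := by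
  obtain ⟨C, hC⟩ := U.exists_bound n fun i j => (j:ℝ) - i
  have hD : (fun ω => (U.D n ω : ℝ)) = fun ω => (U.Re n ω : ℝ) - U.Bl n ω := by
    funext ω; simp [D]
  rw [hD, variance_eq_sub (MemLp.of_bound
    (U.measurable_comp n fun i j => (j:ℝ) - i).aestronglyMeasurable C (ae_of_all _ hC))]
  rfl

end Urn

theorem variance_discrepancy_limit {Ω : Type*} [MeasurableSpace Ω] (μ : MeasureTheory.Measure Ω) [MeasureTheory.IsProbabilityMeasure μ]
    (α B : ℝ) (hα : 0 < α) (w : ℕ → ℝ) (hw : ∀ n, 0 < w n)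
    (hasymp : WeightAsymp w α B)
    (b r : ℕ → ℝ) (hb : ∀ i, 0 < b i) (hr : ∀ i, 0 < r i)
    (hchoice : UrnChoice w b r) (U : Urn μ b r) :
    Tendsto (fun n : ℕ => variance (fun ω => (U.D n ω : ℝ)) μ / (n:ℝ))
      atTop (nhds (1 / (2*α + 1))) := by
  obtain ⟨K, hK, c, hc, hp, hq⟩ := hchoice.exists_rateBounds hα hw hasymp
  obtain ⟨C₁, hC₁, hmean⟩ := Urn.exists_abs_expect_discrepancy_le hα hK hc hp hq hb hr U
  obtain ⟨C₂, hC₂, hsq⟩ := Urn.exists_abs_expect_sq_sub_le hα hK hc hp hq hb hr U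
  have hmart := Urn.tendsto_expect_weightDiff_sq hα hK hc hp hq hb hr U
  have hlim : Tendsto (fun n : ℕ => C₂ / √(n:ℝ) + C₁ ^ 2 / n) atTop (nhds 0) := by
    simpa using (tendsto_const_nhds.div_atTop
      (Real.tendsto_sqrt_atTop.comp tendsto_natCast_atTop_atTop)).add
      (tendsto_const_div_atTop_nhds_zero_nat (C₁ ^ 2))
  refine tendsto_of_tendsto_of_dist hmart ?_
  refine squeeze_zero' (Eventually.of_forall fun _ => dist_nonneg) ?_ hlim
  filter_upwards [eventually_gt_atTop 0] with n hn
  have hn0 : (0:ℝ) < n := by exact_mod_cast hn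
  have h1 := hsq n hn
  have h2 : (U.expect n fun i j => (j:ℝ) - i) ^ 2 ≤ C₁ ^ 2 :=
    sq_le_sq' (abs_le.1 (hmean n hn)).1 (abs_le.1 (hmean n hn)).2
  rw [dist_comm, Real.dist_eq, U.variance_D, Real.rpow_add_one hn0.ne', ← div_div, ← sub_div,
    abs_div, abs_of_pos hn0, show C₂ / √(n:ℝ) = C₂ * √(n:ℝ) / n by
      rw [div_eq_div_iff (by positivity) hn0.ne', mul_assoc, Real.mul_self_sqrt hn0.le],
    ← add_div]
  gcongr
  rw [sub_right_comm]
  refine (abs_sub _ _).trans (add_le_add h1 ?_)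
  rwa [abs_of_nonneg (sq_nonneg _)]
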